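/- arXiv:1708.00615 — 3 statements merged into one kernel-verified Lean document; each statement's English description precedes it below -/
import Mathlib

section
/- For every odd prime p there exists a special Miller p-group G of order p^7 whose automorphism group Aut(G) is elementary abelian of order p^{12} (i.e., Aut(G) is abelian, has order p^{12}, and φ^p = id for every automorphism φ). -/
/-- A Miller group: a finite non-abelian group whose full automorphism group is abelian. -/
def IsMiller (G : Type*) [Group G] : Prop :=
  Finite G ∧ (∃ a b : G, a * b ≠ b * a) ∧ ∀ φ ψ : MulAut G, φ * ψ = ψ * φ

/-- A finite `p`-group is special if its center equals its commutator subgroup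
and this common subgroup is elementary abelian. -/
def IsSpecial (p : ℕ) (G : Type*) [Group G] : Prop :=
  Subgroup.center G = commutator G ∧ ∀ x ∈ Subgroup.center G, x ^ p = 1

/-- `G` is a special Miller `p`-group of order `p ^ 7` whose automorphism group is
elementary abelian of order `p ^ 12`. -/
def IsMorigiExample (p : ℕ) (G : Type*) [Group G] : Prop :=
  Finite G ∧ IsPGroup p G ∧ IsMiller G ∧ IsSpecial p G ∧
    Nat.card G = p ^ 7 ∧ Nat.card (MulAut G) = p ^ 12 ∧ ∀ φ : MulAut G, φ ^ p = 1

namespace MorigiGroup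

variable {p : ℕ}

/-- Reduction modulo `p`. -/
def red (p : ℕ) : ZMod (p ^ 2) →+* ZMod p :=
  ZMod.castHom (dvd_pow_self p two_ne_zero) (ZMod p)

/-- The embedding of `ZMod p` into `ZMod (p ^ 2)` induced by multiplication by `p`. -/
def incl (p : ℕ) : ZMod p →+ ZMod (p ^ 2) :=
  ZMod.lift p ⟨(AddMonoidHom.mulLeft (p : ZMod (p ^ 2))).comp (Int.castAddHom _), by
    have h : ((p ^ 2 : ℕ) : ZMod (p ^ 2)) = 0 := ZMod.natCast_self _
    simpa [sq] using h⟩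

theorem incl_red (x : ZMod (p ^ 2)) : incl p (red p x) = p * x := by
  obtain ⟨n, rfl⟩ := ZMod.intCast_surjective x
  rw [map_intCast]
  exact (ZMod.lift_coe p _ n).trans (by simp)

theorem red_surjective (p : ℕ) : Function.Surjective (red p) := by
  intro x
  obtain ⟨n, rfl⟩ := ZMod.intCast_surjective x
  exact ⟨n, by simp⟩

@[simp]
theorem red_incl (x : ZMod p) : red p (incl p x) = 0 := by
  obtain ⟨y, rfl⟩ := red_surjective p x
  simp [incl_red]

theorem incl_injective (hp : p ≠ 0) : Function.Injective (incl p) := by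
  rw [injective_iff_map_eq_zero]
  intro x hx
  obtain ⟨n, rfl⟩ := ZMod.intCast_surjective x
  have h : ((p * n : ℤ) : ZMod (p ^ 2)) = 0 := by
    have := incl_red (p := p) (n : ZMod (p ^ 2))
    simp only [map_intCast] at this
    push_cast
    rw [← this, hx]
  rw [ZMod.intCast_zmod_eq_zero_iff_dvd] at h
  rw [ZMod.intCast_zmod_eq_zero_iff_dvd]
  push_cast at h
  rw [sq] at h
  exact Int.dvd_of_mul_dvd_mul_left (by exact_mod_cast hp) h

theorem exists_incl_of_red_eq_zero {x : ZMod (p ^ 2)} (hx : red p x = 0) :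
    ∃ y, incl p y = x := by
  obtain ⟨n, rfl⟩ := ZMod.intCast_surjective x
  rw [map_intCast, ZMod.intCast_zmod_eq_zero_iff_dvd] at hx
  obtain ⟨m, rfl⟩ := hx
  refine ⟨red p m, ?_⟩
  rw [incl_red]
  push_cast
  rfl

end MorigiGroup

/-- The underlying set of a central extension of `(ZMod p)⁴` by `(ZMod p)³`, in which the
elements `p * b`, `p * c`, `p * d` are central. -/
@[ext]
structure MorigiGroup (p : ℕ) where
  a : ZMod p
  b : ZMod (p ^ 2)
  c : ZMod (p ^ 2)
  d : ZMod (p ^ 2)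

namespace MorigiGroup

variable {p : ℕ}

instance : Mul (MorigiGroup p) where
  mul x y :=
    ⟨x.a + y.a, x.b + y.b + incl p (x.a * red p y.b),
      x.c + y.c + incl p (red p x.b * red p y.d),
      x.d + y.d + incl p (x.a * red p y.c + red p x.c * red p y.d)⟩

instance : One (MorigiGroup p) where
  one := ⟨0, 0, 0, 0⟩

instance : Inv (MorigiGroup p) where
  inv x :=
    ⟨-x.a, -x.b + incl p (x.a * red p x.b),
      -x.c + incl p (red p x.b * red p x.d),
      -x.d + incl p (x.a * red p x.c + red p x.c * red p x.d)⟩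

@[simp] theorem mul_a (x y : MorigiGroup p) : (x * y).a = x.a + y.a := rfl

@[simp] theorem mul_b (x y : MorigiGroup p) :
    (x * y).b = x.b + y.b + incl p (x.a * red p y.b) := rfl

@[simp] theorem mul_c (x y : MorigiGroup p) :
    (x * y).c = x.c + y.c + incl p (red p x.b * red p y.d) := rfl

@[simp] theorem mul_d (x y : MorigiGroup p) :
    (x * y).d = x.d + y.d + incl p (x.a * red p y.c + red p x.c * red p y.d) := rfl

@[simp] theorem one_a : (1 : MorigiGroup p).a = 0 := rfl
@[simp] theorem one_b : (1 : MorigiGroup p).b = 0 := rfl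
@[simp] theorem one_c : (1 : MorigiGroup p).c = 0 := rfl
@[simp] theorem one_d : (1 : MorigiGroup p).d = 0 := rfl

@[simp] theorem inv_a (x : MorigiGroup p) : x⁻¹.a = -x.a := rfl

@[simp] theorem inv_b (x : MorigiGroup p) : x⁻¹.b = -x.b + incl p (x.a * red p x.b) := rfl

@[simp] theorem inv_c (x : MorigiGroup p) :
    x⁻¹.c = -x.c + incl p (red p x.b * red p x.d) := rfl

@[simp] theorem inv_d (x : MorigiGroup p) :
    x⁻¹.d = -x.d + incl p (x.a * red p x.c + red p x.c * red p x.d) := rfl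

instance : Group (MorigiGroup p) :=
  Group.ofLeftAxioms
    (fun x y z => by
      ext <;> simp [mul_add, add_mul] <;> abel)
    (fun x => by ext <;> simp)
    (fun x => by ext <;> simp; abel)

/-- The central elements of the group. -/
def central (u v w : ZMod p) : MorigiGroup p := ⟨0, incl p u, incl p v, incl p w⟩

theorem mul_eq_mul_mul_central (x y : MorigiGroup p) :
    x * y = y * x * central (x.a * red p y.b - y.a * red p x.b)
      (red p x.b * red p y.d - red p y.b * red p x.d)
      (x.a * red p y.c + red p x.c * red p y.d - y.a * red p x.c - red p y.c * red p x.d) := by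
  ext <;> simp [central] <;> abel

theorem central_inj (hp : p ≠ 0) {u v w u' v' w' : ZMod p} :
    central u v w = central u' v' w' ↔ u = u' ∧ v = v' ∧ w = w' := by
  simp [central, MorigiGroup.ext_iff, (incl_injective hp).eq_iff]

theorem central_zero : central (0 : ZMod p) 0 0 = 1 := by
  ext <;> simp [central]

theorem central_mul (u v w u' v' w' : ZMod p) :
    central u v w * central u' v' w' = central (u + u') (v + v') (w + w') := by
  ext <;> simp [central]

theorem central_mem_center (u v w : ZMod p) : central u v w ∈ Subgroup.center (MorigiGroup p) := by
  rw [Subgroup.mem_center_iff]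
  intro g
  ext <;> simp [central] <;> abel

theorem exists_mul_central {x y : MorigiGroup p} (ha : y.a = x.a) (hb : red p y.b = red p x.b)
    (hc : red p y.c = red p x.c) (hd : red p y.d = red p x.d) :
    ∃ u v w, y = x * central u v w := by
  obtain ⟨u, hu⟩ := exists_incl_of_red_eq_zero (x := y.b - x.b) (by simp [hb])
  obtain ⟨v, hv⟩ := exists_incl_of_red_eq_zero (x := y.c - x.c) (by simp [hc])
  obtain ⟨w, hw⟩ := exists_incl_of_red_eq_zero (x := y.d - x.d) (by simp [hd])
  exact ⟨u, v, w, by ext <;> simp [central, *]⟩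

theorem pow_eq (x : MorigiGroup p) (n : ℕ) :
    x ^ n = ⟨n * x.a, n * x.b + incl p (n.choose 2 * (x.a * red p x.b)),
      n * x.c + incl p (n.choose 2 * (red p x.b * red p x.d)),
      n * x.d + incl p (n.choose 2 * (x.a * red p x.c + red p x.c * red p x.d))⟩ := by
  induction n with
  | zero => ext <;> simp
  | succ n ih =>
    rw [pow_succ, ih]
    have h : ((n + 1).choose 2 : ZMod p) = n + n.choose 2 := by
      rw [Nat.choose_succ_succ' n 1]; simp
    ext <;> simp [h, add_mul, mul_add, mul_assoc] <;> abel

theorem pow_prime (hodd : Odd p) (x : MorigiGroup p) :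
    x ^ p = central (red p x.b) (red p x.c) (red p x.d) := by
  have h : (p.choose 2 : ZMod p) = 0 := by
    obtain ⟨k, rfl⟩ := hodd
    rw [ZMod.natCast_eq_zero_iff, Nat.choose_two_right]
    refine ⟨k, ?_⟩
    rw [Nat.add_sub_cancel, mul_left_comm, Nat.mul_div_cancel_left _ two_pos]
  rw [pow_eq, h]
  ext <;> simp [central, incl_red]

def genA (p : ℕ) : MorigiGroup p := ⟨1, 0, 0, 0⟩
def genB (p : ℕ) : MorigiGroup p := ⟨0, 1, 0, 0⟩
def genC (p : ℕ) : MorigiGroup p := ⟨0, 0, 1, 0⟩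
def genD (p : ℕ) : MorigiGroup p := ⟨0, 0, 0, 1⟩

theorem hom_ext [NeZero p] {H : Type*} [Group H] {f g : MorigiGroup p →* H}
    (ha : f (genA p) = g (genA p)) (hb : f (genB p) = g (genB p))
    (hc : f (genC p) = g (genC p)) (hd : f (genD p) = g (genD p)) : f = g := by
  ext x
  have hx : x = genD p ^ x.d.val * genC p ^ x.c.val * genB p ^ x.b.val * genA p ^ x.a.val := by
    ext <;> simp [pow_eq, genA, genB, genC, genD]
  rw [hx]
  simp only [map_mul, map_pow, ha, hb, hc, hd]

theorem red_eq_of_mul_eq (hp : p ≠ 0) (hodd : Odd p) {x y z : MorigiGroup p}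
    (h : x * y = y * x * z ^ p) :
    x.a * red p y.b - y.a * red p x.b = red p z.b ∧
      red p x.b * red p y.d - red p y.b * red p x.d = red p z.c ∧
      x.a * red p y.c + red p x.c * red p y.d - y.a * red p x.c - red p y.c * red p x.d =
        red p z.d := by
  rw [mul_eq_mul_mul_central, pow_prime hodd] at h
  exact (central_inj hp).1 (mul_left_cancel h)

theorem map_gen (hp : p.Prime) (hodd : Odd p) (φ : MulAut (MorigiGroup p)) :
    (∃ u v w, φ (genA p) = genA p * central u v w) ∧
      (∃ u v w, φ (genB p) = genB p * central u v w) ∧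
      (∃ u v w, φ (genC p) = genC p * central u v w) ∧
      ∃ u v w, φ (genD p) = genD p * central u v w := by
  have : Fact p.Prime := ⟨hp⟩
  have hp0 := hp.ne_zero
  have hrel {x y z : MorigiGroup p} (h : x * y = y * x * z ^ p) :=
    red_eq_of_mul_eq hp0 hodd (x := φ x) (y := φ y) (z := φ z)
      (by simp only [← map_mul, ← map_pow, h])
  have hne {x : MorigiGroup p} (h : x ^ p ≠ 1) :
      ¬ (red p (φ x).b = 0 ∧ red p (φ x).c = 0 ∧ red p (φ x).d = 0) := by
    rintro ⟨h1, h2, h3⟩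
    apply h
    apply φ.injective
    rw [map_pow, map_one, pow_prime hodd, h1, h2, h3, central_zero]
  obtain ⟨a1, a2, a3⟩ : red p (φ (genA p)).b = 0 ∧ red p (φ (genA p)).c = 0 ∧
      red p (φ (genA p)).d = 0 := by
    have h : φ (genA p) ^ p = φ 1 := by
      rw [← map_pow, pow_prime hodd]; simp [genA, central_zero]
    rw [pow_prime hodd, map_one, ← central_zero, central_inj hp0] at h
    exact h
  obtain ⟨ab1, ab2, ab3⟩ := hrel (x := genA p) (y := genB p) (z := genB p) (by
    rw [mul_eq_mul_mul_central, pow_prime hodd]; simp [genA, genB])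
  obtain ⟨ac1, -, ac3⟩ := hrel (x := genA p) (y := genC p) (z := genD p) (by
    rw [mul_eq_mul_mul_central, pow_prime hodd]; simp [genA, genC, genD])
  obtain ⟨ad1, -, ad3⟩ := hrel (x := genA p) (y := genD p) (z := 1) (by
    rw [mul_eq_mul_mul_central, pow_prime hodd]; simp [genA, genD])
  obtain ⟨bd1, bd2, bd3⟩ := hrel (x := genB p) (y := genD p) (z := genC p) (by
    rw [mul_eq_mul_mul_central, pow_prime hodd]; simp [genB, genC, genD])
  obtain ⟨-, -, cd3⟩ := hrel (x := genC p) (y := genD p) (z := genD p) (by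
    rw [mul_eq_mul_mul_central, pow_prime hodd]; simp [genC, genD])
  obtain ⟨bc1, -, bc3⟩ := hrel (x := genB p) (y := genC p) (z := 1) (by
    rw [mul_eq_mul_mul_central, pow_prime hodd]; simp [genB, genC])
  have hB := hne (x := genB p) (by
    rw [pow_prime hodd, Ne, ← central_zero, central_inj hp0]; simp [genB])
  have hD := hne (x := genD p) (by
    rw [pow_prime hodd, Ne, ← central_zero, central_inj hp0]; simp [genD])
  simp only [a1, a2, a3, map_one, one_b, one_d, map_zero, mul_zero, zero_mul, sub_zero,
    add_zero] at ab1 ab2 ab3 ac1 ac3 ad1 ad3 bc1 bc3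
  -- The matrix of the induced map is forced to be the identity, one row after the other.
  have b2 : red p (φ (genB p)).c = 0 := ab2.symm
  have b3 : red p (φ (genB p)).d = 0 := by rw [← ab3, b2, mul_zero]
  have b1 : red p (φ (genB p)).b ≠ 0 := fun h => hB ⟨h, b2, b3⟩
  have a0 : (φ (genA p)).a = 1 := mul_right_cancel₀ b1 (by rw [ab1, one_mul])
  rw [a0, one_mul] at ac1 ac3 ad1 ad3
  have c1 : red p (φ (genC p)).b = 0 := by rw [ac1, ad1]
  have d3 : red p (φ (genD p)).d ≠ 0 := fun h => hD ⟨ad1, ad3, h⟩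
  simp only [b2, b3, c1, ad1, ad3, ac3, mul_zero, zero_mul, sub_zero, add_zero, zero_add,
    zero_sub] at bd1 bd2 bd3 cd3 bc1 bc3
  have d0 : (φ (genD p)).a = 0 := by simpa [b1] using bd1
  have b1' : red p (φ (genB p)).b = 1 := mul_right_cancel₀ d3 (by rw [bd2, one_mul])
  have d3' : red p (φ (genD p)).d = 1 :=
    mul_right_cancel₀ d3 (by rw [one_mul]; simpa [d0] using cd3)
  have c0 : (φ (genC p)).a = 0 := by simpa [b1'] using bc1
  have b0 : (φ (genB p)).a = 0 := by simpa [d3'] using bc3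
  have zero {t : ZMod p} (h : t = 0) : t = red p 0 := h.trans (map_zero _).symm
  have one {t : ZMod p} (h : t = 1) : t = red p 1 := h.trans (map_one _).symm
  exact ⟨exists_mul_central a0 (zero a1) (zero a2) (zero a3),
    exists_mul_central b0 (one b1') (zero b2) (zero b3),
    exists_mul_central c0 (zero c1) (one (ac3.trans d3')) (zero bd3.symm),
    exists_mul_central d0 (zero ad1) (zero ad3) (one d3')⟩

/-- The coordinates of the linear map `(ZMod p)⁴ → ZMod p` with coefficients `v`. -/
def row (v : Fin 4 → ZMod p) (x : MorigiGroup p) : ZMod p :=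
  v 0 * x.a + v 1 * red p x.b + v 2 * red p x.c + v 3 * red p x.d

/-- Multiplication by the central element given by a linear map `(ZMod p)⁴ → (ZMod p)³`. -/
def shift (M : Fin 3 → Fin 4 → ZMod p) (x : MorigiGroup p) : MorigiGroup p :=
  x * central (row (M 0) x) (row (M 1) x) (row (M 2) x)

theorem shift_zero (x : MorigiGroup p) : shift 0 x = x := by
  simp [shift, row, central_zero]

theorem shift_add (M N : Fin 3 → Fin 4 → ZMod p) (x : MorigiGroup p) :
    shift (M + N) x = shift M (shift N x) := by
  ext <;> simp [shift, row, central, add_mul] <;> abel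

theorem shift_mul (M : Fin 3 → Fin 4 → ZMod p) (x y : MorigiGroup p) :
    shift M (x * y) = shift M x * shift M y := by
  ext <;> simp [shift, row, central, mul_add] <;> abel

/-- The central automorphisms attached to linear maps `(ZMod p)⁴ → (ZMod p)³`. -/
def shiftHom (p : ℕ) : Multiplicative (Fin 3 → Fin 4 → ZMod p) →* MulAut (MorigiGroup p) where
  toFun M :=
    { toFun := shift M.toAdd
      invFun := shift (-M.toAdd)
      left_inv := fun x => by rw [← shift_add, neg_add_cancel, shift_zero]
      right_inv := fun x => by rw [← shift_add, add_neg_cancel, shift_zero]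
      map_mul' := shift_mul _ }
  map_one' := MulEquiv.ext shift_zero
  map_mul' M N := MulEquiv.ext (shift_add M.toAdd N.toAdd)

theorem shiftHom_injective (hp : p ≠ 0) : Function.Injective (shiftHom p) := by
  rw [injective_iff_map_eq_one]
  intro M hM
  have h (x : MorigiGroup p) : ∀ i, row (M.toAdd i) x = 0 := by
    have hx : x * _ = x * 1 := (DFunLike.congr_fun hM x).trans (mul_one x).symm
    rw [mul_right_inj, ← central_zero, central_inj hp] at hx
    obtain ⟨h0, h1, h2⟩ := hx
    intro i
    fin_cases i <;> assumption
  apply Multiplicative.toAdd.injective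
  funext i j
  have hA := h (genA p) i
  have hB := h (genB p) i
  have hC := h (genC p) i
  have hD := h (genD p) i
  simp only [row, genA, genB, genC, genD, map_zero, map_one, mul_zero, mul_one, add_zero,
    zero_add] at hA hB hC hD
  fin_cases j <;> assumption

theorem shiftHom_surjective (hp : p.Prime) (hodd : Odd p) :
    Function.Surjective (shiftHom p) := by
  intro φ
  have : NeZero p := ⟨hp.ne_zero⟩
  obtain ⟨⟨a1, a2, a3, ha⟩, ⟨b1, b2, b3, hb⟩, ⟨c1, c2, c3, hc⟩, ⟨d1, d2, d3, hd⟩⟩ :=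
    map_gen hp hodd φ
  refine ⟨Multiplicative.ofAdd ![![a1, b1, c1, d1], ![a2, b2, c2, d2], ![a3, b3, c3, d3]], ?_⟩
  apply MulEquiv.toMonoidHom_injective
  apply hom_ext
  · refine Eq.trans ?_ ha.symm
    simp [shiftHom, shift, row, genA]
  · refine Eq.trans ?_ hb.symm
    simp [shiftHom, shift, row, genB]
  · refine Eq.trans ?_ hc.symm
    simp [shiftHom, shift, row, genC]
  · refine Eq.trans ?_ hd.symm
    simp [shiftHom, shift, row, genD]

/-- The automorphism group is the group of linear maps `(ZMod p)⁴ → (ZMod p)³`. -/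
noncomputable def shiftEquiv (hp : p.Prime) (hodd : Odd p) :
    Multiplicative (Fin 3 → Fin 4 → ZMod p) ≃* MulAut (MorigiGroup p) :=
  MulEquiv.ofBijective (shiftHom p)
    ⟨shiftHom_injective hp.ne_zero, shiftHom_surjective hp hodd⟩

/-- The group as a product of its coordinates. -/
def equivProd (p : ℕ) :
    MorigiGroup p ≃ ZMod p × ZMod (p ^ 2) × ZMod (p ^ 2) × ZMod (p ^ 2) where
  toFun x := (x.a, x.b, x.c, x.d)
  invFun x := ⟨x.1, x.2.1, x.2.2.1, x.2.2.2⟩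

theorem card_eq (p : ℕ) : Nat.card (MorigiGroup p) = p ^ 7 := by
  rw [Nat.card_congr (equivProd p)]
  simp only [Nat.card_prod, Nat.card_zmod]
  ring

theorem mem_center_iff (hp : p ≠ 0) {x : MorigiGroup p} :
    x ∈ Subgroup.center (MorigiGroup p) ↔ ∃ u v w, x = central u v w := by
  constructor
  · intro hx
    rw [Subgroup.mem_center_iff] at hx
    have h (y : MorigiGroup p) := hx y
    simp only [mul_eq_mul_mul_central _ x, mul_eq_left, ← central_zero, central_inj hp] at h
    obtain ⟨hA1, -, hA3⟩ := h (genA p)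
    obtain ⟨hB1, hB2, -⟩ := h (genB p)
    simp only [genA, genB, map_zero, map_one, mul_zero, mul_one, one_mul, zero_mul, sub_zero,
      add_zero, zero_sub, neg_eq_zero] at hA1 hA3 hB1 hB2
    simpa using exists_mul_central (x := 1) (y := x) hB1 (by simpa using hA1) (by simpa using hA3)
      (by simpa using hB2)
  · rintro ⟨u, v, w, rfl⟩
    exact central_mem_center u v w

open scoped commutatorElement

theorem commutatorElement_eq (x y : MorigiGroup p) :
    ⁅x, y⁆ = central (x.a * red p y.b - y.a * red p x.b)
      (red p x.b * red p y.d - red p y.b * red p x.d)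
      (x.a * red p y.c + red p x.c * red p y.d - y.a * red p x.c - red p y.c * red p x.d) := by
  have h := Subgroup.mem_center_iff.1 (central_mem_center (x.a * red p y.b - y.a * red p x.b)
    (red p x.b * red p y.d - red p y.b * red p x.d)
    (x.a * red p y.c + red p x.c * red p y.d - y.a * red p x.c - red p y.c * red p x.d)) (y * x)
  rw [commutatorElement_def, mul_eq_mul_mul_central x y, h]
  group

theorem center_eq_commutator (hp : p ≠ 0) :
    Subgroup.center (MorigiGroup p) = commutator (MorigiGroup p) := by
  apply le_antisymm
  · intro x hx
    obtain ⟨u, v, w, rfl⟩ := (mem_center_iff hp).1 hx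
    obtain ⟨u, rfl⟩ := red_surjective p u
    obtain ⟨v, rfl⟩ := red_surjective p v
    obtain ⟨w, rfl⟩ := red_surjective p w
    have h : central (red p u) (red p v) (red p w) =
        ⁅genA p, ⟨0, u, 0, 0⟩⁆ * ⁅genB p, ⟨0, 0, 0, v⟩⁆ * ⁅genA p, ⟨0, 0, w, 0⟩⁆ := by
      simp [commutatorElement_eq, central_mul, genA, genB]
    rw [h, commutator_def]
    have hm (y z : MorigiGroup p) : ⁅y, z⁆ ∈ ⁅(⊤ : Subgroup (MorigiGroup p)), ⊤⁆ :=
      Subgroup.commutator_mem_commutator (Subgroup.mem_top y) (Subgroup.mem_top z)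
    exact mul_mem (mul_mem (hm _ _) (hm _ _)) (hm _ _)
  · rw [commutator_def, Subgroup.commutator_le]
    intro x _ y _
    rw [commutatorElement_eq]
    exact central_mem_center _ _ _

theorem isMorigiExample (hp : p.Prime) (hodd : Odd p) : IsMorigiExample p (MorigiGroup p) := by
  have : Fact p.Prime := ⟨hp⟩
  have hp0 := hp.ne_zero
  have hfin : Finite (MorigiGroup p) := Finite.of_equiv _ (equivProd p).symm
  refine ⟨hfin, IsPGroup.of_card (card_eq p), ⟨hfin, ⟨genA p, genB p, ?_⟩, ?_⟩,
    ⟨center_eq_commutator hp0, ?_⟩, card_eq p, ?_, ?_⟩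
  · rw [mul_eq_mul_mul_central, Ne, mul_eq_left, ← central_zero, central_inj hp0]
    simp [genA, genB]
  · intro φ ψ
    apply (shiftEquiv hp hodd).symm.injective
    rw [map_mul, map_mul, mul_comm]
  · intro x hx
    obtain ⟨u, v, w, rfl⟩ := (mem_center_iff hp0).1 hx
    rw [pow_prime hodd, ← central_zero]
    simp [central]
  · rw [← Nat.card_congr (shiftEquiv hp hodd).toEquiv]
    simp only [Nat.card_eq_fintype_card, Fintype.card_multiplicative, Fintype.card_pi,
      ZMod.card, Finset.prod_const, Finset.card_univ, Fintype.card_fin]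
    ring
  · intro φ
    apply (shiftEquiv hp hodd).symm.injective
    rw [map_pow, map_one]
    apply Multiplicative.toAdd.injective
    rw [toAdd_pow, toAdd_one]
    funext i j
    simp

end MorigiGroup

/-- Morigi: for every odd prime `p` there is a special Miller `p`-group of order `p ^ 7`
whose automorphism group is elementary abelian of order `p ^ 12`. -/
theorem exists_special_miller_pGroup_order_p_pow_seven
    (p : ℕ) (hp : p.Prime) (hodd : Odd p) :
    ∃ (G : Type) (instG : Group G), @IsMorigiExample p G instG :=
  ⟨MorigiGroup p, inferInstance, MorigiGroup.isMorigiExample hp hodd⟩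
end

section
/- There exists a non-abelian group G of order 2^6 = 64 whose automorphism group Aut(G) is elementary abelian of order 2^7 (i.e., Aut(G) is abelian, has order 2^7, and φ^2 = id for every automorphism φ). -/
/-- `G` is a non-abelian group of order `2 ^ 6 = 64` whose automorphism group is
elementary abelian of order `2 ^ 7`. -/
def IsMillerExample64 (G : Type*) [Group G] : Prop :=
  Finite G ∧ (∃ a b : G, a * b ≠ b * a) ∧ Nat.card G = 2 ^ 6 ∧
    (∀ φ ψ : MulAut G, φ * ψ = ψ * φ) ∧ Nat.card (MulAut G) = 2 ^ 7 ∧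
    ∀ φ : MulAut G, φ ^ 2 = 1

namespace Miller

/-- Multiplication by `4`, as an embedding of `ZMod 2` into `ZMod 8`. -/
def fourMul : ZMod 2 →+ ZMod 8 where
  toFun a := 4 * a.cast
  map_zero' := by decide
  map_add' := by decide

/-- Multiplication by `2`, as an embedding of `ZMod 2` into `ZMod 4`. -/
def twoMul : ZMod 2 →+ ZMod 4 where
  toFun a := 2 * a.cast
  map_zero' := by decide
  map_add' := by decide

/-- Reduction modulo `2` on `ZMod 8`. -/
def red8 : ZMod 8 →+* ZMod 2 := ZMod.castHom (by decide) (ZMod 2)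

/-- Reduction modulo `2` on `ZMod 4`. -/
def red4 : ZMod 4 →+* ZMod 2 := ZMod.castHom (by decide) (ZMod 2)

lemma red8_fourMul : ∀ a, red8 (fourMul a) = 0 := by decide

lemma red4_twoMul : ∀ a, red4 (twoMul a) = 0 := by decide

lemma fourMul_injective : Function.Injective fourMul := by decide

lemma twoMul_injective : Function.Injective twoMul := by decide

lemma two_mul_fourMul : ∀ a, 2 * fourMul a = 0 := by decide

lemma two_mul_twoMul : ∀ a, 2 * twoMul a = 0 := by decide

lemma eq_zero_or_eq_one : ∀ a : ZMod 2, a = 0 ∨ a = 1 := by decide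

lemma red8_unit : ∀ s : (ZMod 8)ˣ, red8 s = 1 := by decide

lemma unit_mul_self : ∀ s : (ZMod 8)ˣ, (s * s : ZMod 8) = 1 := by decide

lemma unit_mul_fourMul : ∀ (s : (ZMod 8)ˣ) (a : ZMod 2), s * fourMul a = fourMul a := by decide

/-- Miller's group `⟨x, y, z ∣ x⁸ = y⁴ = z² = 1, y x y⁻¹ = x⁵, z y z⁻¹ = y⁻¹, x z = z x⟩`,
with `⟨i, j, k⟩` standing for `xⁱ yʲ zᵏ`. -/
@[ext]
structure MillerGroup where
  /-- The exponent of `x`. -/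
  x : ZMod 8
  /-- The exponent of `y`. -/
  y : ZMod 4
  /-- The exponent of `z`. -/
  z : ZMod 2

namespace MillerGroup

instance : DecidableEq MillerGroup := fun _ _ => decidable_of_iff _ MillerGroup.ext_iff.symm

instance : Mul MillerGroup :=
  ⟨fun g h => ⟨g.x + h.x + fourMul (red8 h.x * red4 g.y), g.y + h.y + twoMul (red4 h.y * g.z),
    g.z + h.z⟩⟩

instance : One MillerGroup := ⟨⟨0, 0, 0⟩⟩

instance : Inv MillerGroup :=
  ⟨fun g => ⟨-g.x + fourMul (red8 g.x * red4 g.y), -g.y + twoMul (red4 g.y * g.z), -g.z⟩⟩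

@[simp] lemma mul_x (g h : MillerGroup) :
    (g * h).x = g.x + h.x + fourMul (red8 h.x * red4 g.y) := rfl

@[simp] lemma mul_y (g h : MillerGroup) :
    (g * h).y = g.y + h.y + twoMul (red4 h.y * g.z) := rfl

@[simp] lemma mul_z (g h : MillerGroup) : (g * h).z = g.z + h.z := rfl

@[simp] lemma one_x : (1 : MillerGroup).x = 0 := rfl

@[simp] lemma one_y : (1 : MillerGroup).y = 0 := rfl

@[simp] lemma one_z : (1 : MillerGroup).z = 0 := rfl

@[simp] lemma inv_x (g : MillerGroup) : g⁻¹.x = -g.x + fourMul (red8 g.x * red4 g.y) := rfl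

@[simp] lemma inv_y (g : MillerGroup) : g⁻¹.y = -g.y + twoMul (red4 g.y * g.z) := rfl

@[simp] lemma inv_z (g : MillerGroup) : g⁻¹.z = -g.z := rfl

instance : Group MillerGroup :=
  Group.ofLeftAxioms
    (fun a b c => by
      ext
      · simp only [mul_x, mul_y, map_add, red8_fourMul, red4_twoMul, add_mul, mul_add, add_zero]
        abel
      · simp only [mul_z, mul_y, map_add, red4_twoMul, add_mul, mul_add, add_zero]
        abel
      · simp [add_assoc])
    (fun a => by ext <;> simp)
    (fun a => by
      ext
      · simp [red4_twoMul, add_assoc, ← two_mul, two_mul_fourMul]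
      · simp [add_assoc, ← two_mul, two_mul_twoMul]
      · simp [CharTwo.add_self_eq_zero])

/-- A group element is the triple of its exponents. -/
def equivProd : MillerGroup ≃ ZMod 8 × ZMod 4 × ZMod 2 where
  toFun g := (g.x, g.y, g.z)
  invFun t := ⟨t.1, t.2.1, t.2.2⟩
  left_inv _ := rfl
  right_inv _ := rfl

instance : Finite MillerGroup := Finite.of_equiv _ equivProd.symm

lemma natCard : Nat.card MillerGroup = 2 ^ 6 := by
  simp [Nat.card_congr equivProd]

lemma eq_generators_mul : ∀ g : MillerGroup,
    g = ⟨1, 0, 0⟩ ^ g.x.val * ⟨0, 1, 0⟩ ^ g.y.val * ⟨0, 0, 1⟩ ^ g.z.val := by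
  rintro ⟨i, j, k⟩
  revert i j k
  decide

lemma hom_ext {φ ψ : MulAut MillerGroup} (hx : φ ⟨1, 0, 0⟩ = ψ ⟨1, 0, 0⟩)
    (hy : φ ⟨0, 1, 0⟩ = ψ ⟨0, 1, 0⟩) (hz : φ ⟨0, 0, 1⟩ = ψ ⟨0, 0, 1⟩) : φ = ψ := by
  ext1 g
  rw [eq_generators_mul g]
  simp only [map_mul, map_pow, hx, hy, hz]

/-- The parameters of an automorphism. -/
abbrev Params : Type := (ZMod 8)ˣ × ZMod 2 × ZMod 2 × ZMod 2 × ZMod 2 × ZMod 2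

/-- The map `x ↦ xˢ y²ᵖ`, `y ↦ x⁴ᵛ y¹⁺²ᵠ`, `z ↦ x⁴ʷ y²ʳ z`. -/
def autFun : Params → MillerGroup → MillerGroup
  | (s, p, v, q, w, r), g =>
    ⟨s * g.x + fourMul (v * red4 g.y + w * g.z),
      g.y + twoMul (p * red8 g.x + q * red4 g.y + r * g.z), g.z⟩

lemma autFun_autFun (t : Params) (g : MillerGroup) : autFun t (autFun t g) = g := by
  obtain ⟨s, p, v, q, w, r⟩ := t
  ext
  · simp only [autFun, map_add, red4_twoMul, mul_add, unit_mul_fourMul, ← mul_assoc, unit_mul_self,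
      add_zero, one_mul]
    rw [add_assoc, ← map_add, ← map_add, CharTwo.add_self_eq_zero]
    simp
  · simp only [autFun, map_add, map_mul, red4_twoMul, red8_fourMul, red8_unit, add_zero, one_mul]
    rw [add_assoc, ← map_add, ← map_add, ← map_add, CharTwo.add_self_eq_zero]
    simp
  · rfl

/-- The automorphism with given parameters. -/
def aut (t : Params) : MulAut MillerGroup where
  toFun := autFun t
  invFun := autFun t
  left_inv := autFun_autFun t
  right_inv := autFun_autFun t
  map_mul' g h := by
    obtain ⟨s, p, v, q, w, r⟩ := t
    ext
    · simp only [autFun, mul_x, mul_y, mul_z, map_add, map_mul, red4_twoMul, red8_fourMul,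
        red8_unit, mul_add, unit_mul_fourMul, add_zero, one_mul]
      abel
    · simp only [autFun, mul_x, mul_y, mul_z, map_add, red4_twoMul, red8_fourMul, mul_add, add_zero]
      abel
    · rfl

lemma aut_apply (t : Params) (g : MillerGroup) : aut t g = autFun t g := rfl

lemma aut_injective : Function.Injective aut := by
  rintro ⟨s, p, v, q, w, r⟩ ⟨s', p', v', q', w', r'⟩ h
  have key g := DFunLike.congr_fun h g
  have hx := key ⟨1, 0, 0⟩
  have hy := key ⟨0, 1, 0⟩
  have hz := key ⟨0, 0, 1⟩
  simp [aut_apply, autFun, fourMul_injective.eq_iff,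
    twoMul_injective.eq_iff] at hx hy hz
  simp [Units.ext_iff, hx, hy, hz]

lemma pow_four_of_ne_one : ∀ g : MillerGroup, g ^ 4 ≠ 1 → red8 g.x = 1 ∧ g ^ 4 = ⟨4, 0, 0⟩ := by
  rintro ⟨i, j, k⟩
  revert i j k
  decide

lemma involution_coords : ∀ g : MillerGroup, g * g = 1 →
    red8 g.x = 0 ∧ (g.z = 0 → red4 g.y = 0) ∧
    (red4 g.y = 0 → ∃ w r, g = ⟨fourMul w, twoMul r, g.z⟩) := by
  rintro ⟨i, j, k⟩
  revert i j k
  decide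

lemma coords_of_cube : ∀ g : MillerGroup, red4 g.y = 1 → (g ^ 3).x = g.x → (g ^ 3).y = g.y + 2 →
    ∃ v q, g = ⟨fourMul v, 1 + twoMul q, 0⟩ := by
  rintro ⟨i, j, k⟩
  revert i j k
  decide

lemma exists_unit_eq : ∀ i : ZMod 8, red8 i = 1 → ∃ s : (ZMod 8)ˣ, i = s := by decide

lemma exists_twoMul_eq : ∀ j : ZMod 4, red4 j = 0 → ∃ p, j = twoMul p := by decide

lemma mul_comm_iff (g h : MillerGroup) : g * h = h * g ↔
    red8 h.x * red4 g.y = red8 g.x * red4 h.y ∧ red4 h.y * g.z = red4 g.y * h.z := by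
  rw [MillerGroup.ext_iff]
  simp only [mul_x, mul_y, mul_z, add_comm h.x, add_comm h.y, add_comm h.z, add_right_inj, and_true,
    fourMul_injective.eq_iff, twoMul_injective.eq_iff]

lemma aut_surjective : Function.Surjective aut := by
  intro φ
  obtain ⟨X, hX⟩ : ∃ X, X = φ ⟨1, 0, 0⟩ := ⟨_, rfl⟩
  obtain ⟨Y, hY⟩ : ∃ Y, Y = φ ⟨0, 1, 0⟩ := ⟨_, rfl⟩
  obtain ⟨Z, hZ⟩ : ∃ Z, Z = φ ⟨0, 0, 1⟩ := ⟨_, rfl⟩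
  have hX4 : X ^ 4 ≠ 1 := by
    rw [hX, ← map_pow, map_ne_one_iff _ φ.injective]
    decide
  have hZZ : Z * Z = 1 := by
    rw [hZ, ← map_mul, map_eq_one_iff _ φ.injective]
    decide
  have hXZ : X * Z = Z * X := by
    rw [hX, hZ, ← map_mul, ← map_mul, φ.injective.eq_iff]
    decide
  have hYX : Y * X = X * Y * X ^ 4 := by
    rw [hX, hY, ← map_pow, ← map_mul, ← map_mul, ← map_mul, φ.injective.eq_iff]
    decide
  have hZY : Z * Y = Y ^ 3 * Z := by
    rw [hZ, hY, ← map_pow, ← map_mul, ← map_mul, φ.injective.eq_iff]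
    decide
  have hZY' : Z * Y ≠ Y * Z := by
    rw [hZ, hY, ← map_mul, ← map_mul, φ.injective.ne_iff]
    decide
  obtain ⟨hXx, hXp⟩ := pow_four_of_ne_one X hX4
  obtain ⟨hZx, hZy, hZw⟩ := involution_coords Z hZZ
  have hZz : Z.z = 1 := by
    refine (eq_zero_or_eq_one Z.z).resolve_left fun h => hZY' ?_
    rw [mul_comm_iff, hZx, hZy h, h]
    simp
  rw [mul_comm_iff, hZx, hXx, hZz] at hXZ
  obtain ⟨hZy, hXy⟩ := hXZ
  replace hZy : red4 Z.y = 0 := by simpa using hZy.symm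
  replace hXy : red4 X.y = 0 := by simpa [hZy] using hXy.symm
  rw [hXp, MillerGroup.ext_iff] at hYX
  obtain ⟨hYXx, hYXy, -⟩ := hYX
  have h4 : (4 : ZMod 8) = fourMul 1 := by decide
  have hYy : red4 Y.y = 1 := by
    simpa [hXx, hXy, add_comm Y.x, h4, red8_fourMul, fourMul_injective.eq_iff] using hYXx
  have hXz : X.z = 0 := by
    simpa [hXy, hYy, add_comm Y.y, map_eq_zero_iff _ twoMul_injective] using hYXy
  rw [MillerGroup.ext_iff] at hZY
  obtain ⟨hZYx, hZYy, -⟩ := hZY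
  have h2 : (2 : ZMod 4) = twoMul 1 := by decide
  obtain ⟨v, q, hYc⟩ := coords_of_cube Y hYy
    (by simpa [hZx, hZy, add_comm Z.x, eq_comm] using hZYx)
    (by
      simp only [mul_y, hZy, hYy, hZz, mul_one, zero_mul, map_zero, add_zero] at hZYy
      linear_combination -h2 - hZYy)
  obtain ⟨w, r, hZc⟩ := hZw hZy
  obtain ⟨s, hs⟩ := exists_unit_eq _ hXx
  obtain ⟨p, hp⟩ := exists_twoMul_eq _ hXy
  refine ⟨(s, p, v, q, w, r), hom_ext ?_ ?_ ?_⟩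
  · rw [← hX]
    ext <;> simp [aut_apply, autFun, hs, hp, hXz]
  · rw [← hY, hYc]
    ext <;> simp [aut_apply, autFun]
  · rw [← hZ, hZc, hZz]
    ext <;> simp [aut_apply, autFun]

lemma natCard_mulAut : Nat.card (MulAut MillerGroup) = 2 ^ 7 := by
  rw [← Nat.card_congr (Equiv.ofBijective aut ⟨aut_injective, aut_surjective⟩)]
  have : Fintype.card (ZMod 8)ˣ = 4 := by decide
  simp [this]

lemma mulAut_mul_self (φ : MulAut MillerGroup) : φ * φ = 1 := by
  obtain ⟨t, rfl⟩ := aut_surjective φ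
  ext1 g
  exact autFun_autFun t g

end MillerGroup

end Miller

/-- Miller's example: there is a non-abelian group of order `64` whose automorphism
group is elementary abelian of order `2 ^ 7`. -/
theorem exists_nonabelian_group_order_64_elementary_abelian_aut :
    ∃ (G : Type) (instG : Group G), @IsMillerExample64 G instG := by
  refine ⟨Miller.MillerGroup, inferInstance, inferInstance, ⟨⟨1, 0, 0⟩, ⟨0, 1, 0⟩, by decide⟩,
    Miller.MillerGroup.natCard, fun φ ψ => ?_, Miller.MillerGroup.natCard_mulAut,
    fun φ => (sq φ).trans (Miller.MillerGroup.mulAut_mul_self φ)⟩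
  exact (Commute.of_orderOf_dvd_two (fun φ => orderOf_dvd_of_pow_eq_one
    ((sq φ).trans (Miller.MillerGroup.mulAut_mul_self φ))) φ ψ).eq
end

section
/- For every prime p and every finite group K, there exists a finite special p-group G such that the quotient Aut(G)/Autcent(G) is isomorphic to K. -/
/-- The group of central automorphisms of `G`: automorphisms `φ` inducing the identity
on `G/Z(G)`, i.e. with `g⁻¹ * φ g ∈ Z(G)` for all `g`. -/
def Autcent (G : Type*) [Group G] : Subgroup (MulAut G) where
  carrier := {φ : MulAut G | ∀ g : G, g⁻¹ * φ g ∈ Subgroup.center G}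
  one_mem' := by
    intro g
    simpa using Subgroup.one_mem (Subgroup.center G)
  mul_mem' := by
    intro φ ψ hφ hψ g
    have h1 : g⁻¹ * ψ g ∈ Subgroup.center G := hψ g
    have h2 : (ψ g)⁻¹ * φ (ψ g) ∈ Subgroup.center G := hφ (ψ g)
    have : (g⁻¹ * ψ g) * ((ψ g)⁻¹ * φ (ψ g)) ∈ Subgroup.center G :=
      Subgroup.mul_mem _ h1 h2
    simpa [mul_assoc] using this
  inv_mem' := by
    intro φ hφ g
    have h := Subgroup.inv_mem _ (hφ (φ⁻¹ g))
    simpa [mul_assoc] using h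

instance Autcent.normal (G : Type*) [Group G] : (Autcent G).Normal := by
  constructor
  intro φ hφ ψ g
  have hz : (ψ⁻¹ g)⁻¹ * φ (ψ⁻¹ g) ∈ Subgroup.center G := hφ (ψ⁻¹ g)
  rw [Subgroup.mem_center_iff] at hz ⊢
  intro h
  have key := hz (ψ⁻¹ h)
  have := congrArg ψ key
  simpa [mul_assoc, map_mul] using this

/-- The carry of the addition of two residues modulo `p`, written with representatives
in `{0, …, p - 1}`. -/
def carry {p : ℕ} (x y : ZMod p) : ZMod p := ((x.val + y.val) / p : ℕ)

theorem carry_comm {p : ℕ} (x y : ZMod p) : carry x y = carry y x := by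
  simp [carry, add_comm]

@[simp]
theorem carry_zero {p : ℕ} [NeZero p] (x : ZMod p) : carry x 0 = 0 := by
  simp [carry, Nat.div_eq_of_lt x.val_lt]

@[simp]
theorem zero_carry {p : ℕ} [NeZero p] (x : ZMod p) : carry 0 x = 0 := by
  rw [carry_comm, carry_zero]

theorem Nat.div_add_mod_add_div {p : ℕ} (hp : 0 < p) (m n : ℕ) :
    m / p + (m % p + n) / p = (m + n) / p := by
  conv_rhs => rw [← Nat.div_add_mod m p, add_assoc, Nat.mul_add_div hp]

theorem carry_assoc {p : ℕ} [NeZero p] (x y z : ZMod p) :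
    carry x y + carry (x + y) z = carry y z + carry x (y + z) := by
  have hp : 0 < p := NeZero.pos p
  rw [carry_comm x (y + z)]
  simp only [carry, ZMod.val_add, ← Nat.cast_add, Nat.div_add_mod_add_div hp]
  congr 2
  ring

theorem natCast_mul_val_div_succ {p : ℕ} [NeZero p] (n : ℕ) (x : ZMod p) :
    (((n + 1) * x.val / p : ℕ) : ZMod p) = (n * x.val / p : ℕ) + carry (n • x) x := by
  have hp : 0 < p := NeZero.pos p
  have h : (n • x).val = n * x.val % p := by
    rw [nsmul_eq_mul, ZMod.val_mul, ZMod.val_natCast, Nat.mod_mul_mod]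
  rw [carry, h, ← Nat.cast_add, Nat.div_add_mod_add_div hp, add_one_mul]

/-- The class two `p`-group with generators `αᵢ`, `βⱼ`, in which the `αᵢ` commute with each
other, the `βⱼ` commute with each other, the commutators `[αᵢ, βⱼ]` are independent central
elements of order `p`, and `αᵢ ^ p = ∏ⱼ [αᵢ, βⱼ] ^ (t i j)`, `βⱼ ^ p = ∏ᵢ [αᵢ, βⱼ] ^ (s j i)`. -/
@[ext]
structure TwistedHeis {I J : Type*} {p : ℕ} (t : I → J → ZMod p) (s : J → I → ZMod p) where
  a : I → ZMod p
  b : J → ZMod p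
  w : I → J → ZMod p

namespace TwistedHeis

variable {I J : Type*} {p : ℕ} {t : I → J → ZMod p} {s : J → I → ZMod p}

instance : Mul (TwistedHeis t s) where
  mul x y := ⟨x.a + y.a, x.b + y.b, fun i j => x.w i j + y.w i j + x.a i * y.b j +
    carry (x.a i) (y.a i) * t i j + carry (x.b j) (y.b j) * s j i⟩

instance : One (TwistedHeis t s) := ⟨⟨0, 0, 0⟩⟩

instance : Inv (TwistedHeis t s) where
  inv x := ⟨-x.a, -x.b, fun i j => -x.w i j + x.a i * x.b j -
    carry (-x.a i) (x.a i) * t i j - carry (-x.b j) (x.b j) * s j i⟩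

@[simp] theorem mul_a (x y : TwistedHeis t s) : (x * y).a = x.a + y.a := rfl
@[simp] theorem mul_b (x y : TwistedHeis t s) : (x * y).b = x.b + y.b := rfl
theorem mul_w (x y : TwistedHeis t s) (i : I) (j : J) :
    (x * y).w i j = x.w i j + y.w i j + x.a i * y.b j +
      carry (x.a i) (y.a i) * t i j + carry (x.b j) (y.b j) * s j i := rfl
@[simp] theorem one_a : (1 : TwistedHeis t s).a = 0 := rfl
@[simp] theorem one_b : (1 : TwistedHeis t s).b = 0 := rfl
@[simp] theorem one_w : (1 : TwistedHeis t s).w = 0 := rfl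
@[simp] theorem inv_a (x : TwistedHeis t s) : x⁻¹.a = -x.a := rfl
@[simp] theorem inv_b (x : TwistedHeis t s) : x⁻¹.b = -x.b := rfl
theorem inv_w (x : TwistedHeis t s) (i : I) (j : J) :
    x⁻¹.w i j = -x.w i j + x.a i * x.b j -
      carry (-x.a i) (x.a i) * t i j - carry (-x.b j) (x.b j) * s j i := rfl

instance [NeZero p] : Group (TwistedHeis t s) :=
  Group.ofLeftAxioms
    (fun x y z => by
      ext i j
      · simp [add_assoc]
      · simp [add_assoc]
      · simp only [mul_w, mul_a, mul_b, Pi.add_apply]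
        linear_combination t i j * carry_assoc (x.a i) (y.a i) (z.a i) +
          s j i * carry_assoc (x.b j) (y.b j) (z.b j))
    (fun x => by ext <;> simp [mul_w])
    (fun x => by
      ext i j
      · simp
      · simp
      · simp only [mul_w, inv_w, inv_a, inv_b, Pi.neg_apply, one_w, Pi.zero_apply]
        ring)

instance [NeZero p] [Finite I] [Finite J] : Finite (TwistedHeis t s) :=
  Finite.of_injective (fun x : TwistedHeis t s => (x.a, x.b, x.w)) fun x y h => by
    simp only [Prod.mk.injEq] at h
    exact TwistedHeis.ext h.1 h.2.1 h.2.2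

theorem commute_iff {x y : TwistedHeis t s} :
    Commute x y ↔ ∀ i j, x.a i * y.b j = y.a i * x.b j := by
  constructor
  · intro h i j
    have := congrArg (fun z => z.w i j) h.eq
    simp only [mul_w] at this
    rw [carry_comm (y.a i), carry_comm (y.b j)] at this
    linear_combination this
  · intro h
    ext i j
    · simp [add_comm]
    · simp [add_comm]
    · simp only [mul_w]
      rw [carry_comm (y.a i), carry_comm (y.b j)]
      linear_combination h i j

section NeZero

variable [NeZero p]

@[simp]
theorem pow_a (x : TwistedHeis t s) (n : ℕ) : (x ^ n).a = n • x.a := by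
  induction n with
  | zero => simp
  | succ n ih => rw [pow_succ, mul_a, ih, succ_nsmul]

@[simp]
theorem pow_b (x : TwistedHeis t s) (n : ℕ) : (x ^ n).b = n • x.b := by
  induction n with
  | zero => simp
  | succ n ih => rw [pow_succ, mul_b, ih, succ_nsmul]

theorem pow_w (x : TwistedHeis t s) (n : ℕ) (i : I) (j : J) :
    (x ^ n).w i j = n * x.w i j + n.choose 2 * (x.a i * x.b j) +
      (n * (x.a i).val / p : ℕ) * t i j + (n * (x.b j).val / p : ℕ) * s j i := by
  induction n with
  | zero => simp
  | succ n ih =>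
    rw [pow_succ, mul_w, ih, natCast_mul_val_div_succ, natCast_mul_val_div_succ,
      Nat.choose_succ_succ' n 1, Nat.choose_one_right, pow_a, pow_b]
    simp only [Pi.smul_apply, nsmul_eq_mul, Nat.cast_add, Nat.cast_one]
    ring

theorem pow_prime_w (x : TwistedHeis t s) (h : x.a = 0 ∨ x.b = 0) (i : I) (j : J) :
    (x ^ p).w i j = x.a i * t i j + x.b j * s j i := by
  have hp : 0 < p := NeZero.pos p
  rw [pow_w, Nat.mul_div_cancel_left _ hp, Nat.mul_div_cancel_left _ hp]
  have h' : x.a i * x.b j = 0 := by rcases h with h | h <;> simp [h]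
  simp [h']

end NeZero

section Prime

variable [Fact p.Prime]

theorem commute_iff_b {x y : TwistedHeis t s} (hb : x.b = 0) (ha : x.a ≠ 0) :
    Commute x y ↔ y.b = 0 := by
  obtain ⟨i, hi⟩ := Function.ne_iff.1 ha
  rw [commute_iff]
  constructor
  · intro h
    ext j
    simpa [hb, show x.a i ≠ 0 from hi] using h i j
  · intro h
    simp [h, hb]

theorem commute_iff_a {x y : TwistedHeis t s} (ha : x.a = 0) (hb : x.b ≠ 0) :
    Commute x y ↔ y.a = 0 := by
  obtain ⟨j, hj⟩ := Function.ne_iff.1 hb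
  rw [commute_iff]
  constructor
  · intro h
    ext i
    simpa [ha, show x.b j ≠ 0 from hj, eq_comm] using h i j
  · intro h
    simp [h, ha]

theorem mem_center_iff [Nonempty I] [Nonempty J] {x : TwistedHeis t s} :
    x ∈ Subgroup.center (TwistedHeis t s) ↔ x.a = 0 ∧ x.b = 0 := by
  classical
  rw [Subgroup.mem_center_iff]
  constructor
  · intro h
    have h' : ∀ y : TwistedHeis t s, Commute x y := fun y => (h y).symm
    refine ⟨funext fun i => ?_, funext fun j => ?_⟩
    · simpa using commute_iff.1 (h' ⟨0, 1, 0⟩) i (Classical.arbitrary J)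
    · simpa [eq_comm] using commute_iff.1 (h' ⟨1, 0, 0⟩) (Classical.arbitrary I) j
  · rintro ⟨ha, hb⟩ y
    exact (commute_iff.2 (by simp [ha, hb])).eq.symm

theorem isPGroup : IsPGroup p (TwistedHeis t s) := by
  refine fun x => ⟨2, ?_⟩
  have ha : (x ^ p).a = 0 := by ext; simp
  have hb : (x ^ p).b = 0 := by ext; simp
  rw [pow_two, pow_mul]
  ext i j
  · simp
  · simp
  · simp [pow_prime_w (x ^ p) (Or.inl ha), ha, hb]

/-- The embedding of the center. -/
def centerHom : Multiplicative (I → J → ZMod p) →* TwistedHeis t s where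
  toFun w := ⟨0, 0, w.toAdd⟩
  map_one' := rfl
  map_mul' v w := by ext <;> simp [mul_w]

theorem mul_eq_center_mul {x y : TwistedHeis t s} {w : I → J → ZMod p} :
    x * y = ⟨0, 0, w⟩ * (y * x) ↔ ∀ i j, w i j = x.a i * y.b j - y.a i * x.b j := by
  constructor
  · intro h i j
    have := congrArg (fun z => z.w i j) h
    simp only [mul_w, Pi.zero_apply, zero_mul, zero_carry] at this
    rw [carry_comm (y.a i), carry_comm (y.b j)] at this
    linear_combination -this
  · intro h
    ext i j
    · simp [add_comm]
    · simp [add_comm]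
    · simp only [mul_w, h, Pi.zero_apply, zero_mul, zero_carry]
      rw [carry_comm (y.a i), carry_comm (y.b j)]
      ring

theorem single_mem_commutator [DecidableEq I] [DecidableEq J] (i : I) (j : J) (c : ZMod p) :
    (⟨0, 0, Pi.single i (Pi.single j c)⟩ : TwistedHeis t s) ∈ commutator (TwistedHeis t s) := by
  have h : (⟨Pi.single i c, 0, 0⟩ : TwistedHeis t s) * ⟨0, Pi.single j 1, 0⟩ =
      ⟨0, 0, Pi.single i (Pi.single j c)⟩ * (⟨0, Pi.single j 1, 0⟩ * ⟨Pi.single i c, 0, 0⟩) := by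
    rw [mul_eq_center_mul]
    intro i' j'
    by_cases hi : i' = i <;> by_cases hj : j' = j <;> simp [hi, hj]
  rw [commutator_def]
  have := Subgroup.commutator_mem_commutator
    (Subgroup.mem_top (⟨Pi.single i c, 0, 0⟩ : TwistedHeis t s))
    (Subgroup.mem_top (⟨0, Pi.single j 1, 0⟩ : TwistedHeis t s))
  rwa [commutatorElement_def, mul_assoc, ← mul_inv_rev, h, mul_inv_cancel_right] at this

theorem center_eq_commutator [Finite I] [Finite J] [Nonempty I] [Nonempty J] :
    Subgroup.center (TwistedHeis t s) = commutator (TwistedHeis t s) := by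
  classical
  have := Fintype.ofFinite I
  have := Fintype.ofFinite J
  apply le_antisymm
  · intro x hx
    obtain ⟨ha, hb⟩ := mem_center_iff.1 hx
    have hx' : x = centerHom (Multiplicative.ofAdd x.w) := TwistedHeis.ext ha hb rfl
    have hw : x.w = ∑ i, ∑ j, Pi.single i (Pi.single j (x.w i j)) := by
      ext i j
      simp [Finset.sum_apply, Pi.single_apply, apply_ite (fun f : J → ZMod p => f j)]
    rw [hx', hw]
    refine Subgroup.mem_comap.1 ?_
    simp only [ofAdd_sum]
    exact Subgroup.prod_mem _ fun i _ => Subgroup.prod_mem _ fun j _ =>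
      Subgroup.mem_comap.2 (single_mem_commutator i j _)
  · rw [commutator_def, Subgroup.commutator_le]
    intro x _ y _
    rw [mem_center_iff, commutatorElement_def]
    simp

theorem isSpecial [Finite I] [Finite J] [Nonempty I] [Nonempty J] :
    IsSpecial p (TwistedHeis t s) := by
  refine ⟨center_eq_commutator, fun x hx => ?_⟩
  obtain ⟨ha, hb⟩ := mem_center_iff.1 hx
  ext i j
  · simp
  · simp
  · simp [pow_prime_w x (Or.inl ha), ha, hb]

/-- `x` commutes with some `y` not lying in the subgroup generated by `x` and the center. -/
def HasIndependentCommuting {G : Type*} [Group G] (x : G) : Prop :=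
  ∃ y, Commute x y ∧ ∀ n : ℕ, (x ^ n)⁻¹ * y ∉ Subgroup.center G

theorem _root_.MulEquiv.apply_mem_center_iff {G H : Type*} [Group G] [Group H] (φ : G ≃* H)
    {x : G} : φ x ∈ Subgroup.center H ↔ x ∈ Subgroup.center G := by
  simp only [Subgroup.mem_center_iff, φ.surjective.forall, ← map_mul, φ.apply_eq_iff_eq]

theorem HasIndependentCommuting.map {G H : Type*} [Group G] [Group H] {x : G}
    (h : HasIndependentCommuting x) (φ : G ≃* H) : HasIndependentCommuting (φ x) := by
  obtain ⟨y, hxy, hy⟩ := h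
  refine ⟨φ y, hxy.map φ, fun n => ?_⟩
  rw [← map_pow, ← map_inv, ← map_mul, φ.apply_mem_center_iff]
  exact hy n

theorem card_b_eq_zero [Finite I] [Finite J] :
    Nat.card {x : TwistedHeis t s // x.b = 0} =
      p ^ Nat.card I * Nat.card (I → J → ZMod p) := by
  have e : {x : TwistedHeis t s // x.b = 0} ≃ (I → ZMod p) × (I → J → ZMod p) :=
    { toFun x := (x.1.a, x.1.w)
      invFun y := ⟨⟨y.1, 0, y.2⟩, rfl⟩
      left_inv x := Subtype.ext (TwistedHeis.ext rfl x.2.symm rfl)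
      right_inv _ := rfl }
  rw [Nat.card_congr e, Nat.card_prod, Nat.card_fun, Nat.card_zmod]

theorem card_a_eq_zero [Finite I] [Finite J] :
    Nat.card {x : TwistedHeis t s // x.a = 0} =
      p ^ Nat.card J * Nat.card (I → J → ZMod p) := by
  have e : {x : TwistedHeis t s // x.a = 0} ≃ (J → ZMod p) × (I → J → ZMod p) :=
    { toFun x := (x.1.b, x.1.w)
      invFun y := ⟨⟨0, y.1, y.2⟩, rfl⟩
      left_inv x := Subtype.ext (TwistedHeis.ext x.2.symm rfl rfl)
      right_inv _ := rfl }
  rw [Nat.card_congr e, Nat.card_prod, Nat.card_fun, Nat.card_zmod]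

section Finite

variable [Nontrivial I] [Nontrivial J]

theorem hasIndependentCommuting_of_b {x : TwistedHeis t s} (hb : x.b = 0) :
    HasIndependentCommuting x := by
  classical
  obtain ⟨i, hi⟩ : ∃ i, x.a ≠ 0 → x.a i ≠ 0 := by
    by_cases h : x.a = 0
    · exact ⟨Classical.arbitrary I, fun h' => (h' h).elim⟩
    · obtain ⟨i, hi⟩ := Function.ne_iff.1 h
      exact ⟨i, fun _ => hi⟩
  obtain ⟨k, hk⟩ := exists_ne i
  refine ⟨⟨Pi.single k 1, 0, 0⟩, commute_iff.2 (by simp [hb]), fun n hn => ?_⟩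
  have h := (mem_center_iff.1 hn).1
  have h₁ := congrFun h i
  have h₂ := congrFun h k
  by_cases hx : x.a = 0
  · simp [hx] at h₂
  · have hn : (n : ZMod p) = 0 := by simpa [hk.symm, hi hx] using h₁
    simp [hn] at h₂

theorem hasIndependentCommuting_of_a {x : TwistedHeis t s} (ha : x.a = 0) :
    HasIndependentCommuting x := by
  classical
  obtain ⟨j, hj⟩ : ∃ j, x.b ≠ 0 → x.b j ≠ 0 := by
    by_cases h : x.b = 0
    · exact ⟨Classical.arbitrary J, fun h' => (h' h).elim⟩
    · obtain ⟨j, hj⟩ := Function.ne_iff.1 h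
      exact ⟨j, fun _ => hj⟩
  obtain ⟨k, hk⟩ := exists_ne j
  refine ⟨⟨0, Pi.single k 1, 0⟩, commute_iff.2 (by simp [ha]), fun n hn => ?_⟩
  have h := (mem_center_iff.1 hn).2
  have h₁ := congrFun h j
  have h₂ := congrFun h k
  by_cases hx : x.b = 0
  · simp [hx] at h₂
  · have hn : (n : ZMod p) = 0 := by simpa [hk.symm, hj hx] using h₁
    simp [hn] at h₂

theorem a_eq_zero_or_b_eq_zero {x : TwistedHeis t s} (h : HasIndependentCommuting x) :
    x.a = 0 ∨ x.b = 0 := by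
  by_contra! hx
  obtain ⟨i, hi⟩ := Function.ne_iff.1 hx.1
  obtain ⟨j, hj⟩ := Function.ne_iff.1 hx.2
  rw [Pi.zero_apply] at hi hj
  obtain ⟨y, hxy, hy⟩ := h
  rw [commute_iff] at hxy
  have hb : ∀ j', y.b j' = y.a i / x.a i * x.b j' := fun j' => by
    field_simp
    linear_combination hxy i j'
  have ha : ∀ i', y.a i' = y.a i / x.a i * x.a i' := fun i' => by
    have h₁ := hxy i' j
    rw [hb] at h₁
    apply mul_right_cancel₀ hj
    linear_combination -h₁
  refine hy (y.a i / x.a i).val (mem_center_iff.2 ⟨?_, ?_⟩)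
  · ext i'
    rw [mul_a, inv_a, pow_a, Pi.add_apply, Pi.neg_apply, Pi.smul_apply, nsmul_eq_mul,
      ZMod.natCast_zmod_val, ha i', neg_add_cancel, Pi.zero_apply]
  · ext j'
    rw [mul_b, inv_b, pow_b, Pi.add_apply, Pi.neg_apply, Pi.smul_apply, nsmul_eq_mul,
      ZMod.natCast_zmod_val, hb j', neg_add_cancel, Pi.zero_apply]

theorem map_congr (φ : MulAut (TwistedHeis t s)) {x y : TwistedHeis t s} (ha : x.a = y.a)
    (hb : x.b = y.b) : (φ x).a = (φ y).a ∧ (φ x).b = (φ y).b := by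
  have h : x⁻¹ * y ∈ Subgroup.center (TwistedHeis t s) :=
    mem_center_iff.2 ⟨by simp [ha], by simp [hb]⟩
  rw [← φ.apply_mem_center_iff, mem_center_iff, map_mul, map_inv] at h
  simpa [neg_add_eq_zero] using h

/-- The linear map induced by an automorphism on the span of the `αᵢ`. -/
def mapA (φ : MulAut (TwistedHeis t s)) : (I → ZMod p) →ₗ[ZMod p] (I → ZMod p) :=
  AddMonoidHom.toZModLinearMap p
    (AddMonoidHom.mk' (fun u => (φ ⟨u, 0, 0⟩).a) fun u v => by
      rw [← mul_a, ← map_mul]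
      exact (map_congr φ (by simp) (by simp)).1)

/-- The linear map induced by an automorphism on the span of the `βⱼ`. -/
def mapB (φ : MulAut (TwistedHeis t s)) : (J → ZMod p) →ₗ[ZMod p] (J → ZMod p) :=
  AddMonoidHom.toZModLinearMap p
    (AddMonoidHom.mk' (fun v => (φ ⟨0, v, 0⟩).b) fun u v => by
      rw [← mul_b, ← map_mul]
      exact (map_congr φ (by simp) (by simp)).2)

variable [Finite I] [Finite J]

theorem map_b_eq_zero (hIJ : Nat.card I ≠ Nat.card J) (φ : MulAut (TwistedHeis t s))
    {x : TwistedHeis t s} (hx : x.b = 0) : (φ x).b = 0 := by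
  let u : TwistedHeis t s := ⟨1, 0, 0⟩
  have hu : u.a ≠ 0 := one_ne_zero
  have hφu : ¬ ((φ u).a = 0 ∧ (φ u).b = 0) := by
    rw [← mem_center_iff, φ.apply_mem_center_iff, mem_center_iff]
    exact fun h => hu h.1
  have comm : ∀ y, Commute (φ u) (φ y) ↔ y.b = 0 := fun y => by
    rw [← commute_iff_b (x := u) rfl hu, Commute, Commute, SemiconjBy, SemiconjBy,
      ← map_mul, ← map_mul, φ.apply_eq_iff_eq]
  rcases a_eq_zero_or_b_eq_zero ((hasIndependentCommuting_of_b (x := u) rfl).map φ) with h | h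
  · have h₁ : ∀ y, y.b = 0 ↔ (φ y).a = 0 := fun y => by
      rw [← comm, commute_iff_a h fun h' => hφu ⟨h, h'⟩]
    have h₂ := Nat.card_congr (φ.toEquiv.subtypeEquiv
      (p := fun y => y.b = 0) (q := fun y => y.a = 0) h₁)
    rw [card_b_eq_zero, card_a_eq_zero] at h₂
    exact (hIJ (Nat.pow_right_injective (Fact.out : p.Prime).two_le
      (Nat.eq_of_mul_eq_mul_right Nat.card_pos h₂))).elim
  · exact (commute_iff_b h fun h' => hφu ⟨h', h⟩).1 ((comm x).2 hx)

theorem map_a_eq_zero (hIJ : Nat.card I ≠ Nat.card J) (φ : MulAut (TwistedHeis t s))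
    {x : TwistedHeis t s} (hx : x.a = 0) : (φ x).a = 0 := by
  rcases a_eq_zero_or_b_eq_zero ((hasIndependentCommuting_of_a hx).map φ) with h | h
  · exact h
  · have hb : x.b = 0 := by simpa using map_b_eq_zero hIJ φ⁻¹ h
    exact (mem_center_iff.1 (φ.apply_mem_center_iff.2 (mem_center_iff.2 ⟨hx, hb⟩))).1

theorem map_a (hIJ : Nat.card I ≠ Nat.card J) (φ : MulAut (TwistedHeis t s))
    (x : TwistedHeis t s) : (φ x).a = mapA φ x.a := by
  have h := (map_congr φ (x := x) (y := ⟨x.a, 0, 0⟩ * ⟨0, x.b, 0⟩) (by simp) (by simp)).1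
  rw [h, map_mul, mul_a, map_a_eq_zero hIJ φ (x := ⟨0, x.b, 0⟩) rfl, add_zero]
  rfl

theorem map_b (hIJ : Nat.card I ≠ Nat.card J) (φ : MulAut (TwistedHeis t s))
    (x : TwistedHeis t s) : (φ x).b = mapB φ x.b := by
  have h := (map_congr φ (x := x) (y := ⟨x.a, 0, 0⟩ * ⟨0, x.b, 0⟩) (by simp) (by simp)).2
  rw [h, map_mul, mul_b, map_b_eq_zero hIJ φ (x := ⟨x.a, 0, 0⟩) rfl, zero_add]
  rfl

theorem mapA_injective (hIJ : Nat.card I ≠ Nat.card J) (φ : MulAut (TwistedHeis t s)) :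
    Function.Injective (mapA φ) := by
  refine Function.LeftInverse.injective (g := mapA φ⁻¹) fun u => ?_
  have h := map_a hIJ φ⁻¹ (φ ⟨u, 0, 0⟩)
  rw [MulAut.inv_apply_self] at h
  exact h.symm

theorem mapB_injective (hIJ : Nat.card I ≠ Nat.card J) (φ : MulAut (TwistedHeis t s)) :
    Function.Injective (mapB φ) := by
  refine Function.LeftInverse.injective (g := mapB φ⁻¹) fun v => ?_
  have h := map_b hIJ φ⁻¹ (φ ⟨0, v, 0⟩)
  rw [MulAut.inv_apply_self] at h
  exact h.symm

theorem map_tensor_w (hIJ : Nat.card I ≠ Nat.card J) (φ : MulAut (TwistedHeis t s))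
    (u : I → ZMod p) (v : J → ZMod p) (i : I) (j : J) :
    (φ ⟨0, 0, fun i j => u i * v j⟩).w i j = mapA φ u i * mapB φ v j := by
  have h : (⟨u, 0, 0⟩ : TwistedHeis t s) * ⟨0, v, 0⟩ =
      ⟨0, 0, fun i j => u i * v j⟩ * (⟨0, v, 0⟩ * ⟨u, 0, 0⟩) :=
    mul_eq_center_mul.2 (by simp)
  have hz : φ ⟨0, 0, fun i j => u i * v j⟩ =
      ⟨0, 0, (φ ⟨0, 0, fun i j => u i * v j⟩).w⟩ :=
    TwistedHeis.ext (map_a_eq_zero hIJ φ rfl) (map_b_eq_zero hIJ φ rfl) rfl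
  have h' := congrArg φ h
  rw [map_mul, map_mul, map_mul, hz, mul_eq_center_mul] at h'
  simpa [map_a hIJ, map_b hIJ] using h' i j

theorem map_pow_alpha_w (hIJ : Nat.card I ≠ Nat.card J) (φ : MulAut (TwistedHeis t s))
    (u : I → ZMod p) (i : I) (j : J) :
    (φ ⟨0, 0, fun i j => u i * t i j⟩).w i j = mapA φ u i * t i j := by
  have h : (⟨0, 0, fun i j => u i * t i j⟩ : TwistedHeis t s) = ⟨u, 0, 0⟩ ^ p := by
    ext i j
    · simp
    · simp
    · simp [pow_prime_w]
  rw [h, map_pow, pow_prime_w _ (Or.inr (map_b_eq_zero hIJ φ rfl)), map_a hIJ, map_b hIJ]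
  simp

theorem map_pow_beta_w (hIJ : Nat.card I ≠ Nat.card J) (φ : MulAut (TwistedHeis t s))
    (v : J → ZMod p) (i : I) (j : J) :
    (φ ⟨0, 0, fun i j => v j * s j i⟩).w i j = mapB φ v j * s j i := by
  have h : (⟨0, 0, fun i j => v j * s j i⟩ : TwistedHeis t s) = ⟨0, v, 0⟩ ^ p := by
    ext i j
    · simp
    · simp
    · simp [pow_prime_w]
  rw [h, map_pow, pow_prime_w _ (Or.inl (map_a_eq_zero hIJ φ rfl)), map_a hIJ, map_b hIJ]
  simp

theorem mapA_single_mul [DecidableEq I] (hIJ : Nat.card I ≠ Nat.card J)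
    (φ : MulAut (TwistedHeis t s)) (i i' : I) (j : J) :
    mapA φ (Pi.single i 1) i' * mapB φ (t i) j = mapA φ (Pi.single i 1) i' * t i' j := by
  rw [← map_tensor_w hIJ, ← map_pow_alpha_w hIJ]
  congr 3
  ext k l
  by_cases h : k = i
  · rw [h]
  · simp [h]

theorem mapB_single_mul [DecidableEq J] (hIJ : Nat.card I ≠ Nat.card J)
    (φ : MulAut (TwistedHeis t s)) (j j' : J) (i : I) :
    mapB φ (Pi.single j 1) j' * mapA φ (s j) i = mapB φ (Pi.single j 1) j' * s j' i := by
  rw [mul_comm, ← map_tensor_w hIJ, ← map_pow_beta_w hIJ]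
  congr 3
  ext k l
  by_cases h : l = j
  · rw [h, mul_comm]
  · simp [h]

end Finite

end Prime

end TwistedHeis

section Monomial

variable {F I J : Type*} [Field F] [DecidableEq I]

theorem exists_monomial {f : (I → F) →ₗ[F] (I → F)} {g : (J → F) → (J → F)}
    {t : I → J → F} (hf : Function.Injective f) (ht : Function.Injective t)
    (h : ∀ i i' j, f (Pi.single i 1) i' * g (t i) j = f (Pi.single i 1) i' * t i' j) :
    ∃ (σ : I → I) (c : I → F), σ.Injective ∧ (∀ i, c i ≠ 0) ∧
      (∀ i, f (Pi.single i 1) = Pi.single (σ i) (c i)) ∧ ∀ i, g (t i) = t (σ i) := by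
  have hne : ∀ i, ∃ k, f (Pi.single i 1) k ≠ 0 := fun i => by
    refine Function.ne_iff.1 fun h₀ => ?_
    have := hf (h₀.trans (map_zero f).symm)
    simp at this
  choose σ hσ using hne
  have hg : ∀ i k, f (Pi.single i 1) k ≠ 0 → g (t i) = t k := fun i k hk =>
    funext fun j => mul_left_cancel₀ hk (h i k j)
  have hsingle : ∀ i, f (Pi.single i 1) = Pi.single (σ i) (f (Pi.single i 1) (σ i)) := by
    intro i
    ext k
    by_cases hk : k = σ i
    · rw [hk, Pi.single_eq_same]
    · rw [Pi.single_eq_of_ne hk]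
      by_contra h₀
      exact hk (ht ((hg i k h₀).symm.trans (hg i _ (hσ i))))
  refine ⟨σ, fun i => f (Pi.single i 1) (σ i), fun i i' hi => ?_, hσ, hsingle,
    fun i => hg i _ (hσ i)⟩
  by_contra hii
  have h₁ : f (f (Pi.single i' 1) (σ i) • Pi.single i 1) =
      f (f (Pi.single i 1) (σ i) • Pi.single i' 1) := by
    rw [map_smul, map_smul, hsingle i, hsingle i', ← hi]
    ext k
    by_cases hk : k = σ i <;> simp [hk, mul_comm]
  have h₂ := congrFun (hf h₁) i'
  rw [Pi.smul_apply, Pi.smul_apply, Pi.single_eq_of_ne (Ne.symm hii), Pi.single_eq_same,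
    smul_zero, smul_eq_mul, mul_one] at h₂
  exact hσ i h₂.symm

theorem monomial_apply [Finite I] {f : (I → F) →ₗ[F] (I → F)} {σ : I → I} {c : I → F}
    (hσ : σ.Injective) (h : ∀ i, f (Pi.single i 1) = Pi.single (σ i) (c i)) (u : I → F) (i : I) :
    f u (σ i) = u i * c i := by
  have := Fintype.ofFinite I
  rw [LinearMap.pi_apply_eq_sum_univ f u, Finset.sum_apply, Finset.sum_eq_single i]
  · rw [show (fun j => if i = j then (1 : F) else 0) = Pi.single i 1 by
      ext j; simp [Pi.single_apply, eq_comm], h]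
    simp
  · intro k _ hk
    rw [show (fun j => if k = j then (1 : F) else 0) = Pi.single k 1 by
      ext j; simp [Pi.single_apply, eq_comm], h]
    simp [hσ.ne hk.symm]
  · simp

theorem monomial_coeff_eq_one [Finite I] {f : (I → F) →ₗ[F] (I → F)} {σ : I → I} {c : I → F}
    (hσ : σ.Injective) (hc : ∀ i, c i ≠ 0)
    (h : ∀ i, f (Pi.single i 1) = Pi.single (σ i) (c i)) {s : J → I → F} {τ : J → J}
    (hs : ∀ j, f (s j) = s (τ j)) (h01 : ∀ j i, s j i = 0 ∨ s j i = 1)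
    (hcov : ∀ i, ∃ j, s j i = 1) (i : I) : c i = 1 := by
  obtain ⟨j, hj⟩ := hcov i
  have h₁ := monomial_apply hσ h (s j) i
  rw [hs, hj, one_mul] at h₁
  rcases h01 (τ j) (σ i) with h₂ | h₂
  · exact (hc i (h₁.symm.trans h₂)).elim
  · exact h₁.symm.trans h₂

end Monomial

namespace TwistedHeis

variable {I J : Type*} {p : ℕ} {t : I → J → ZMod p} {s : J → I → ZMod p} [Fact p.Prime]

theorem exists_perm_of_mulAut [Nontrivial I] [Nontrivial J] [Finite I] [Finite J]
    (hIJ : Nat.card I ≠ Nat.card J) (ht : Function.Injective t) (hs : Function.Injective s)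
    (ht01 : ∀ i j, t i j = 0 ∨ t i j = 1) (hs01 : ∀ j i, s j i = 0 ∨ s j i = 1)
    (htcov : ∀ j, ∃ i, t i j = 1) (hscov : ∀ i, ∃ j, s j i = 1)
    (φ : MulAut (TwistedHeis t s)) :
    ∃ (σ : I → I) (τ : J → J), σ.Injective ∧ τ.Injective ∧
      (∀ i j, t (σ i) (τ j) = t i j) ∧ (∀ i j, s (τ j) (σ i) = s j i) ∧
      ∀ x, (∀ i, (φ x).a (σ i) = x.a i) ∧ ∀ j, (φ x).b (τ j) = x.b j := by
  classical
  obtain ⟨σ, c, hσ, hc, hfσ, hgt⟩ :=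
    exists_monomial (mapA_injective hIJ φ) ht (mapA_single_mul hIJ φ)
  obtain ⟨τ, d, hτ, hd, hgτ, hfs⟩ :=
    exists_monomial (mapB_injective hIJ φ) hs (mapB_single_mul hIJ φ)
  have hA : ∀ u i, mapA φ u (σ i) = u i := fun u i => by
    rw [monomial_apply hσ hfσ, monomial_coeff_eq_one hσ hc hfσ hfs hs01 hscov, mul_one]
  have hB : ∀ v j, mapB φ v (τ j) = v j := fun v j => by
    rw [monomial_apply hτ hgτ, monomial_coeff_eq_one hτ hd hgτ hgt ht01 htcov, mul_one]
  refine ⟨σ, τ, hσ, hτ, fun i j => ?_, fun i j => ?_, fun x => ⟨fun i => ?_, fun j => ?_⟩⟩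
  · rw [← hgt, hB]
  · rw [← hfs, hA]
  · rw [map_a hIJ, hA]
  · rw [map_b hIJ, hB]

/-- The automorphisms permuting the generators `αᵢ` and `βⱼ`. -/
def permAut {K : Type*} [Group K] (f : K →* Equiv.Perm I) (g : K →* Equiv.Perm J)
    (ht : ∀ k i j, t (f k i) (g k j) = t i j) (hs : ∀ k i j, s (g k j) (f k i) = s j i) :
    K →* MulAut (TwistedHeis t s) :=
  @MulDistribMulAction.toMulAut K (TwistedHeis t s) _ _
    { smul k x := ⟨fun i => x.a (f k⁻¹ i), fun j => x.b (g k⁻¹ j),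
        fun i j => x.w (f k⁻¹ i) (g k⁻¹ j)⟩
      one_smul x := by
        change TwistedHeis.mk _ _ _ = x
        simp
      mul_smul k l x := by
        change TwistedHeis.mk _ _ _ =
          ⟨fun i => x.a (f l⁻¹ (f k⁻¹ i)), fun j => x.b (g l⁻¹ (g k⁻¹ j)),
            fun i j => x.w (f l⁻¹ (f k⁻¹ i)) (g l⁻¹ (g k⁻¹ j))⟩
        simp
      smul_one k := rfl
      smul_mul k x y := by
        ext i j
        · rfl
        · rfl
        · change (x * y).w _ _ = _
          rw [mul_w, mul_w, ← ht k⁻¹ i j, ← hs k⁻¹ i j]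
          rfl }

/-- If the bipartite relations encoded by `t` and `s` have no automorphisms besides those coming
from a faithful action of `K`, then `Aut(G) / Autcent(G)` is isomorphic to `K`. -/
theorem nonempty_mulAut_quotient_mulEquiv [Nontrivial I] [Nontrivial J] [Finite I] [Finite J]
    (hIJ : Nat.card I ≠ Nat.card J) (htinj : Function.Injective t) (hsinj : Function.Injective s)
    (ht01 : ∀ i j, t i j = 0 ∨ t i j = 1) (hs01 : ∀ j i, s j i = 0 ∨ s j i = 1)
    (htcov : ∀ j, ∃ i, t i j = 1) (hscov : ∀ i, ∃ j, s j i = 1)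
    {K : Type*} [Group K] (f : K →* Equiv.Perm I) (g : K →* Equiv.Perm J)
    (ht : ∀ k i j, t (f k i) (g k j) = t i j) (hs : ∀ k i j, s (g k j) (f k i) = s j i)
    (hf : Function.Injective f)
    (hrigid : ∀ (σ : I → I) (τ : J → J), σ.Injective → τ.Injective →
      (∀ i j, t (σ i) (τ j) = t i j) → (∀ i j, s (τ j) (σ i) = s j i) →
      ∃ k, (∀ i, σ i = f k i) ∧ ∀ j, τ j = g k j) :
    Nonempty ((MulAut (TwistedHeis t s) ⧸ Autcent (TwistedHeis t s)) ≃* K) := by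
  classical
  let ρ : K →* MulAut (TwistedHeis t s) := permAut f g ht hs
  have hρa : ∀ k x i, (ρ k x).a (f k i) = x.a i := fun k x i =>
    congrArg x.a (by simp)
  have hρb : ∀ k x j, (ρ k x).b (g k j) = x.b j := fun k x j =>
    congrArg x.b (by simp)
  refine ⟨(MulEquiv.ofBijective ((QuotientGroup.mk' (Autcent (TwistedHeis t s))).comp ρ)
    ⟨?_, fun q => ?_⟩).symm⟩
  · rw [injective_iff_map_eq_one]
    intro k hk
    have hk' : ρ k ∈ Autcent (TwistedHeis t s) := (QuotientGroup.eq_one_iff _).1 hk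
    apply (injective_iff_map_eq_one f).1 hf
    ext i
    have h := (mem_center_iff.1 (hk' ⟨Pi.single i 1, 0, 0⟩)).1
    rw [mul_a, inv_a, neg_add_eq_zero] at h
    have h' := hρa k ⟨Pi.single i 1, 0, 0⟩ i
    rw [← h] at h'
    by_contra hne
    simp [show f k i ≠ i from hne] at h'
  · obtain ⟨φ, rfl⟩ := QuotientGroup.mk'_surjective _ q
    obtain ⟨σ, τ, hσ, hτ, hσt, hσs, hφ⟩ :=
      exists_perm_of_mulAut hIJ htinj hsinj ht01 hs01 htcov hscov φ
    obtain ⟨k, hk, hk'⟩ := hrigid σ τ hσ hτ hσt hσs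
    refine ⟨k, QuotientGroup.eq.2 fun x => ?_⟩
    have ha : (φ x).a = (ρ k x).a := by
      ext i
      obtain ⟨i, rfl⟩ := (f k).surjective i
      rw [hρa, ← hk, (hφ x).1]
    have hb : (φ x).b = (ρ k x).b := by
      ext j
      obtain ⟨j, rfl⟩ := (g k).surjective j
      rw [hρb, ← hk', (hφ x).2]
    have h := map_congr (ρ k)⁻¹ ha hb
    rw [MulAut.inv_apply_self] at h
    rw [mem_center_iff, mul_a, mul_b, inv_a, inv_b, MulAut.mul_apply, h.1, h.2]
    simp

end TwistedHeis

/-- Left multiplication on the first component. -/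
def mulLeftFst (K L : Type*) [Group K] : K →* Equiv.Perm (K × L) where
  toFun k := (Equiv.mulLeft k).prodCongr (Equiv.refl L)
  map_one' := by ext <;> simp
  map_mul' k l := by ext <;> simp [mul_assoc]

theorem mulLeftFst_injective (K L : Type*) [Group K] [Nonempty L] :
    Function.Injective (mulLeftFst K L) := fun k l h =>
  mul_right_cancel
    (congrArg Prod.fst (Equiv.congr_fun h ((1 : K), Classical.arbitrary L)) : k * 1 = l * 1)

/-- The bipartite relation recording the `p`-th powers of the generators `αᵢ`. -/
def RelT {K : Type*} (i : K × K) (j : K × Option K) : Prop :=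
  j.1 = i.1 ∧ (j.2 = none ∨ j.2 = some i.2)

/-- The bipartite relation recording the `p`-th powers of the generators `βⱼ`. -/
def RelS {K : Type*} [Mul K] [LE K] : K × Option K → K × K → Prop
  | (x, none), i => i.1 = x * i.2
  | (x, some l), i => i.1 = x ∧ i.2 ≤ l

section Rel

variable {K : Type*}

theorem exists_relT (j : K × Option K) : ∃ i, RelT i j := by
  rcases j with ⟨x, _ | l⟩
  · exact ⟨(x, x), rfl, Or.inl rfl⟩
  · exact ⟨(x, l), rfl, Or.inr rfl⟩

theorem relT_ext {i i' : K × K} (h : ∀ j, RelT i j ↔ RelT i' j) : i = i' := by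
  obtain ⟨h₁, h₂⟩ := (h (i.1, some i.2)).1 ⟨rfl, Or.inr rfl⟩
  exact Prod.ext h₁ (by simpa using h₂)

variable [Group K]

theorem relT_mulLeftFst (k : K) (i : K × K) (j : K × Option K) :
    RelT (mulLeftFst K K k i) (mulLeftFst K (Option K) k j) ↔ RelT i j := by
  simp [RelT, mulLeftFst]

variable [LinearOrder K]

theorem relS_mulLeftFst (k : K) (i : K × K) (j : K × Option K) :
    RelS (mulLeftFst K (Option K) k j) (mulLeftFst K K k i) ↔ RelS j i := by
  rcases j with ⟨x, _ | l⟩ <;> simp [RelS, mulLeftFst, mul_assoc]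

theorem exists_relS (i : K × K) : ∃ j, RelS j i :=
  ⟨(i.1, some i.2), rfl, le_rfl⟩

theorem relS_ext [Nontrivial K] {j j' : K × Option K} (h : ∀ i, RelS j i ↔ RelS j' i) :
    j = j' := by
  have mixed : ∀ x x' l : K, ¬ ∀ i, RelS (x, none) i ↔ RelS (x', some l) i := by
    intro x x' l h
    obtain ⟨k, hk⟩ := exists_ne (1 : K)
    have h₁ := ((h (x * 1, 1)).1 rfl).1
    have h₂ := ((h (x * k, k)).1 rfl).1
    exact hk (mul_left_cancel (h₂.trans h₁.symm))
  rcases j with ⟨x, _ | l⟩ <;> rcases j' with ⟨x', _ | l'⟩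
  · have h₁ : x * 1 = x' * 1 := (h (x * 1, 1)).1 rfl
    rw [mul_right_cancel h₁]
  · exact (mixed _ _ _ h).elim
  · exact (mixed _ _ _ fun i => (h i).symm).elim
  · obtain ⟨h₁, h₂⟩ := (h (x, l)).1 ⟨rfl, le_rfl⟩
    obtain ⟨-, h₃⟩ := (h (x', l')).2 ⟨rfl, le_rfl⟩
    exact Prod.ext h₁ (congrArg some (le_antisymm h₂ h₃))

theorem exists_mul_left_of_rel [Finite K] [Nontrivial K] {σ : K × K → K × K}
    {τ : K × Option K → K × Option K} (hσ : σ.Injective) (hτ : τ.Injective)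
    (hT : ∀ i j, RelT (σ i) (τ j) ↔ RelT i j) (hS : ∀ i j, RelS (τ j) (σ i) ↔ RelS j i) :
    ∃ k : K, (∀ i, σ i = (k * i.1, i.2)) ∧ ∀ j, τ j = (k * j.1, j.2) := by
  have hnone : ∀ y, (τ (y, none)).2 = none := by
    intro y
    obtain ⟨l, l', hl⟩ := exists_pair_ne K
    obtain ⟨h₁, h₂⟩ := (hT (y, l) (y, none)).2 ⟨rfl, Or.inl rfl⟩
    obtain ⟨h₁', h₂'⟩ := (hT (y, l') (y, none)).2 ⟨rfl, Or.inl rfl⟩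
    rcases h₂ with h₂ | h₂
    · exact h₂
    · rcases h₂' with h₂' | h₂'
      · exact h₂'
      · have h₃ : σ (y, l) = σ (y, l') :=
          Prod.ext (h₁.symm.trans h₁') (Option.some_injective _ (h₂.symm.trans h₂'))
        exact (hl (congrArg Prod.snd (hσ h₃))).elim
  have hfst : ∀ y l, (σ (y, l)).1 = (τ (y, none)).1 := fun y l =>
    ((hT (y, l) (y, none)).2 ⟨rfl, Or.inl rfl⟩).1.symm
  have hsome : ∀ y l, τ (y, some l) = ((τ (y, none)).1, some (σ (y, l)).2) := by
    intro y l
    obtain ⟨h₁, h₂⟩ := (hT (y, l) (y, some l)).2 ⟨rfl, Or.inr rfl⟩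
    rw [hfst] at h₁
    rcases h₂ with h₂ | h₂
    · have h₃ : τ (y, some l) = τ (y, none) := Prod.ext h₁ (h₂.trans (hnone y).symm)
      simpa using hτ h₃
    · exact Prod.ext h₁ h₂
  have hsnd : ∀ y l, (σ (y, l)).2 = l := by
    intro y
    have hle : ∀ k l, (σ (y, k)).2 ≤ (σ (y, l)).2 ↔ k ≤ l := by
      intro k l
      have := hS (y, k) (y, some l)
      rw [hsome] at this
      simpa [RelS, hfst] using this
    have hmono : StrictMono fun l => (σ (y, l)).2 := strictMono_of_le_iff_le fun k l => (hle k l).symm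
    exact fun l => le_antisymm hmono.apply_le hmono.le_apply
  have hmul : ∀ y k, (τ (y * k, none)).1 = (τ (y, none)).1 * k := by
    intro y k
    have h := (hS (y * k, k) (y, none)).2 rfl
    rw [show τ (y, none) = ((τ (y, none)).1, none) from Prod.ext rfl (hnone y)] at h
    rw [← hfst _ k]
    simpa [RelS, hsnd] using h
  have hk : ∀ y, (τ (y, none)).1 = (τ (1, none)).1 * y := fun y => by
    simpa using hmul 1 y
  refine ⟨(τ (1, none)).1, fun i => Prod.ext ?_ (hsnd _ _), ?_⟩
  · exact (hfst _ _).trans (hk _)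
  · rintro ⟨y, _ | l⟩
    · exact Prod.ext (hk _) (hnone _)
    · rw [hsome, hsnd, hk]

end Rel

/-- Heineken–Liebeck / Hughes: for every prime `p` and finite group `K` there is a
finite special `p`-group `G` with `Aut(G)/Autcent(G) ≅ K`. -/
theorem exists_special_pGroup_aut_mod_autcent_iso
    (p : ℕ) (hp : p.Prime) (K : Type) [Group K] [Finite K] :
    ∃ (G : Type) (instG : Group G),
      @Finite G ∧ @IsPGroup p G instG ∧ @IsSpecial p G instG ∧
        Nonempty ((MulAut G ⧸ @Autcent G instG) ≃* K) := by
  have : Fact p.Prime := ⟨hp⟩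
  rcases subsingleton_or_nontrivial K with hK | hK
  · refine ⟨Unit, inferInstance, inferInstance, fun _ => ⟨0, rfl⟩,
      ⟨Subsingleton.elim _ _, fun _ _ => rfl⟩, ?_⟩
    have : Subsingleton (MulAut Unit) := ⟨fun φ ψ => by ext⟩
    have : Unique (MulAut Unit ⧸ Autcent Unit) := ⟨⟨1⟩, fun q => by
      obtain ⟨φ, rfl⟩ := QuotientGroup.mk_surjective q
      exact congrArg _ (Subsingleton.elim φ 1)⟩
    have : Unique K := uniqueOfSubsingleton 1
    exact ⟨MulEquiv.ofUnique⟩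
  · classical
    have := Fintype.ofFinite K
    let _ : LinearOrder K := LinearOrder.lift' (Fintype.equivFin K) (Fintype.equivFin K).injective
    let t : K × K → K × Option K → ZMod p := fun i j => if RelT i j then 1 else 0
    let s : K × Option K → K × K → ZMod p := fun j i => if RelS j i then 1 else 0
    have ht : ∀ i j i' j', t i j = t i' j' ↔ (RelT i j ↔ RelT i' j') := fun i j i' j' => by
      by_cases h : RelT i j <;> by_cases h' : RelT i' j' <;> simp [t, h, h']
    have hs : ∀ j i j' i', s j i = s j' i' ↔ (RelS j i ↔ RelS j' i') := fun j i j' i' => by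
      by_cases h : RelS j i <;> by_cases h' : RelS j' i' <;> simp [s, h, h']
    refine ⟨TwistedHeis t s, inferInstance, inferInstance, TwistedHeis.isPGroup,
      TwistedHeis.isSpecial, TwistedHeis.nonempty_mulAut_quotient_mulEquiv ?_ ?_ ?_ ?_ ?_ ?_ ?_
        (mulLeftFst K K) (mulLeftFst K (Option K)) ?_ ?_ (mulLeftFst_injective K K) ?_⟩
    · have h := Nat.card_pos (α := K)
      rw [Nat.card_prod, Nat.card_prod, Finite.card_option]
      exact fun h' => (Nat.lt_succ_self _).ne (Nat.eq_of_mul_eq_mul_left h h')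
    · exact fun i i' h => relT_ext fun j => (ht _ _ _ _).1 (congrFun h j)
    · exact fun j j' h => relS_ext fun i => (hs _ _ _ _).1 (congrFun h i)
    · exact fun i j => (ite_eq_or_eq _ _ _).symm
    · exact fun j i => (ite_eq_or_eq _ _ _).symm
    · exact fun j => (exists_relT j).imp fun i h => if_pos h
    · exact fun i => (exists_relS i).imp fun j h => if_pos h
    · exact fun k i j => (ht _ _ _ _).2 (relT_mulLeftFst k i j)
    · exact fun k i j => (hs _ _ _ _).2 (relS_mulLeftFst k i j)
    · intro σ τ hσ hτ hT hS
      exact exists_mul_left_of_rel hσ hτ (fun i j => (ht _ _ _ _).1 (hT i j))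
        fun i j => (hs _ _ _ _).1 (hS i j)
end
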